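/- Let X and Y be real normed vector spaces, let b : X × Y → ℝ be a bilinear form, and let Z_h ⊆ X and Y_h ⊆ Y be finite-dimensional subspaces with dim Z_h < dim Y_h. Then there exists a nonzero y_h ∈ Y_h such that b(z_h, y_h) = 0 for every z_h ∈ Z_h; consequently the discrete inf-sup condition fails for every constant β > 0, i.e. for every β > 0 there is a nonzero y_h ∈ Y_h with b(z_h, y_h) < β ‖z_h‖_X ‖y_h‖_Y for all nonzero z_h ∈ Z_h. (Operator-level content of Theorems 3.1 and 3.2, proved via the rank–nullity theorem.) -/

import Mathlib

/-- If `dim Z_h < dim Y_h`, then there is a nonzero `y_h ∈ Y_h` with `b(z_h, y_h) = 0` for all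
`z_h ∈ Z_h`; consequently, the discrete inf-sup condition fails for every constant `β > 0`. -/
theorem discrete_infsup_fails_of_dim_lt
    (X Y : Type*) [NormedAddCommGroup X] [NormedSpace ℝ X]
    [NormedAddCommGroup Y] [NormedSpace ℝ Y]
    (b : X →ₗ[ℝ] Y →ₗ[ℝ] ℝ)
    (Zh : Subspace ℝ X) (Yh : Subspace ℝ Y)
    [FiniteDimensional ℝ Zh] [FiniteDimensional ℝ Yh]
    (hdim : Module.finrank ℝ Zh < Module.finrank ℝ Yh) :
    (∃ y ∈ Yh, y ≠ 0 ∧ ∀ z ∈ Zh, b z y = 0) ∧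
      (∀ β : ℝ, 0 < β →
        ∃ y ∈ Yh, y ≠ 0 ∧ ∀ z ∈ Zh, z ≠ 0 → b z y < β * ‖z‖ * ‖y‖) := by
  have hker : ∃ y ∈ Yh, y ≠ 0 ∧ ∀ z ∈ Zh, b z y = 0 := by
    let T : Yh →ₗ[ℝ] Module.Dual ℝ Zh := (b.domRestrict₁₂ Zh Yh).flip
    have hT : LinearMap.ker T ≠ ⊥ :=
      LinearMap.ker_ne_bot_of_finrank_lt (by rwa [Subspace.dual_finrank_eq])
    obtain ⟨y, hy, hy0⟩ := Submodule.exists_mem_ne_zero_of_ne_bot hT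
    exact ⟨y, y.2, fun h => hy0 (Subtype.ext h),
      fun z hz => LinearMap.congr_fun (LinearMap.mem_ker.mp hy) ⟨z, hz⟩⟩
  refine ⟨hker, fun β hβ => ?_⟩
  obtain ⟨y, hy, hy0, hb⟩ := hker
  refine ⟨y, hy, hy0, fun z hz hz0 => ?_⟩
  rw [hb z hz]
  positivity
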